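/- Let v, F : ℝ × U → ℝ³ be smooth time-dependent vector fields. Then the commutator of the material derivative with the (matrix) curl satisfies [D_t, curl]F := D_t(curl F) − curl(D_t F) = (∇v)ᵀ(∇F)ᵀ − (∇F)(∇v) pointwise on ℝ × U; componentwise, for all i, j: D_t(∂_j F^i − ∂_i F^j) − (∂_j (D_t F)^i − ∂_i (D_t F)^j) = ∂_i v^k ∂_k F^j − ∂_k F^i ∂_j v^k. -/

import Mathlib

/-- Spatial partial derivative `∂_j f` of a scalar function on `ℝ × ℝ³`. -/
noncomputable def pdx (j : Fin 3) (f : ℝ × (Fin 3 → ℝ) → ℝ) (p : ℝ × (Fin 3 → ℝ)) : ℝ :=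
  fderiv ℝ f p (0, Pi.single j 1)

/-- Time partial derivative `∂_t f` of a scalar function on `ℝ × ℝ³`. -/
noncomputable def pdt (f : ℝ × (Fin 3 → ℝ) → ℝ) (p : ℝ × (Fin 3 → ℝ)) : ℝ :=
  fderiv ℝ f p (1, 0)

/-- Material derivative `D_t f = ∂_t f + vᵏ ∂_k f` along the velocity field `v`. -/
noncomputable def Dt (v : ℝ × (Fin 3 → ℝ) → Fin 3 → ℝ) (f : ℝ × (Fin 3 → ℝ) → ℝ)
    (p : ℝ × (Fin 3 → ℝ)) : ℝ :=
  pdt f p + ∑ k : Fin 3, v p k * pdx k f p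

/-- The directional derivative of `fderiv ℝ f · w` along `u` is the second derivative of `f`. -/
theorem fderiv_fderiv_apply {E : Type*} [NormedAddCommGroup E] [NormedSpace ℝ E]
    {f : E → ℝ} {p : E} (hf : ContDiffAt ℝ 2 f p) (u w : E) :
    DifferentiableAt ℝ (fun q => fderiv ℝ f q w) p ∧
      fderiv ℝ (fun q => fderiv ℝ f q w) p u = fderiv ℝ (fderiv ℝ f) p u w := by
  have h : DifferentiableAt ℝ (fderiv ℝ f) p :=
    (hf.fderiv_right (m := 1) (by norm_num)).differentiableAt one_ne_zero
  refine ⟨h.clm_apply (differentiableAt_const w), ?_⟩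
  rw [fderiv_clm_apply h (differentiableAt_const w)]
  simp

/-- Spatial partial derivatives fail to commute with `Dt` by the gradient of the velocity. -/
theorem Dt_pdx_sub_pdx_Dt {v : ℝ × (Fin 3 → ℝ) → Fin 3 → ℝ} {f : ℝ × (Fin 3 → ℝ) → ℝ}
    {p : ℝ × (Fin 3 → ℝ)} (hv : DifferentiableAt ℝ v p) (hf : ContDiffAt ℝ 2 f p)
    (j : Fin 3) :
    Dt v (pdx j f) p - pdx j (Dt v f) p
      = -∑ k : Fin 3, pdx j (fun r => v r k) p * pdx k f p := by
  have hvk : ∀ k, DifferentiableAt ℝ (fun r => v r k) p := differentiableAt_pi.1 hv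
  have hsymm : ∀ u w, fderiv ℝ (fderiv ℝ f) p u w = fderiv ℝ (fderiv ℝ f) p w u :=
    hf.isSymmSndFDerivAt (by simp)
  have hD : ∀ w, DifferentiableAt ℝ (fun q => fderiv ℝ f q w) p :=
    fun w => (fderiv_fderiv_apply hf 0 w).1
  have key : pdx j (Dt v f) p = fderiv ℝ (fderiv ℝ f) p (0, Pi.single j 1) (1, 0)
      + ∑ k : Fin 3, (v p k * fderiv ℝ (fderiv ℝ f) p (0, Pi.single j 1) (0, Pi.single k 1)
        + pdx k f p * pdx j (fun r => v r k) p) := by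
    unfold pdx Dt pdt pdx
    rw [fderiv_fun_add (hD _) (DifferentiableAt.fun_sum fun k _ => (hvk k).fun_mul (hD _)),
      fderiv_fun_sum fun k _ => (hvk k).fun_mul (hD _)]
    simp [fderiv_fun_mul (hvk _) (hD _), (fderiv_fderiv_apply hf _ _).2]
  have key' : Dt v (pdx j f) p = fderiv ℝ (fderiv ℝ f) p (1, 0) (0, Pi.single j 1)
      + ∑ k : Fin 3, v p k * fderiv ℝ (fderiv ℝ f) p (0, Pi.single k 1) (0, Pi.single j 1) := by
    unfold Dt pdt pdx
    simp [(fderiv_fderiv_apply hf _ _).2]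
  rw [key, key', hsymm (1, 0)]
  simp only [hsymm (0, Pi.single j 1) (0, Pi.single _ 1), Finset.sum_add_distrib,
    mul_comm (pdx _ f p)]
  ring

/-- The material derivative is compatible with differences of differentiable functions. -/
theorem Dt_sub {v : ℝ × (Fin 3 → ℝ) → Fin 3 → ℝ} {f g : ℝ × (Fin 3 → ℝ) → ℝ}
    {p : ℝ × (Fin 3 → ℝ)} (hf : DifferentiableAt ℝ f p) (hg : DifferentiableAt ℝ g p) :
    Dt v (fun q => f q - g q) p = Dt v f p - Dt v g p := by
  simp only [Dt, pdt, pdx, fderiv_fun_sub hf hg, sub_apply, mul_sub,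
    Finset.sum_sub_distrib]
  ring

/-- [D_t, curl]F = (∇v)ᵀ(∇F)ᵀ − (∇F)(∇v), componentwise:
D_t(∂_j Fⁱ − ∂_i Fʲ) − (∂_j (D_t F)ⁱ − ∂_i (D_t F)ʲ)
  = ∂_i vᵏ ∂_k Fʲ − ∂_k Fⁱ ∂_j vᵏ. -/
theorem commutator_Dt_curl (U : Set (Fin 3 → ℝ)) (hU : IsOpen U)
    (v F : ℝ × (Fin 3 → ℝ) → Fin 3 → ℝ)
    (hv : ContDiffOn ℝ (⊤ : ℕ∞) v (Set.univ ×ˢ U))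
    (hF : ContDiffOn ℝ (⊤ : ℕ∞) F (Set.univ ×ˢ U)) :
    ∀ t : ℝ, ∀ x ∈ U, ∀ i j : Fin 3,
      Dt v (fun q => pdx j (fun r => F r i) q - pdx i (fun r => F r j) q) (t, x)
        - (pdx j (fun q => Dt v (fun r => F r i) q) (t, x)
            - pdx i (fun q => Dt v (fun r => F r j) q) (t, x))
      = (∑ k : Fin 3, pdx i (fun r => v r k) (t, x) * pdx k (fun r => F r j) (t, x))
        - ∑ k : Fin 3, pdx k (fun r => F r i) (t, x) * pdx j (fun r => v r k) (t, x) := by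
  intro t x hx i j
  have hmem : Set.univ ×ˢ U ∈ nhds (t, x) := (isOpen_univ.prod hU).mem_nhds ⟨trivial, hx⟩
  have hv' : DifferentiableAt ℝ v (t, x) := (hv.contDiffAt hmem).differentiableAt (by simp)
  have hF' : ∀ k, ContDiffAt ℝ 2 (fun r => F r k) (t, x) :=
    contDiffAt_pi.1 ((hF.contDiffAt hmem).of_le (WithTop.coe_le_coe.2 le_top))
  have hd : ∀ k l, DifferentiableAt ℝ (pdx l fun r => F r k) (t, x) :=
    fun k l => (fderiv_fderiv_apply (hF' k) 0 (0, Pi.single l 1)).1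
  have hi := Dt_pdx_sub_pdx_Dt hv' (hF' i) j
  have hj := Dt_pdx_sub_pdx_Dt hv' (hF' j) i
  rw [Dt_sub (hd i j) (hd j i)]
  simp only [mul_comm (pdx _ (fun r => F r i) (t, x))]
  linear_combination hi - hj
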